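/- Let σ ∈ Σ_n be a permutation different from the decreasing permutation (σ(j) = n+1−j), let f be a maximal flag in F^n with label σ, let t_σ be the smallest ascent of σ, and let V_f be the t_σ-th subspace of f. If g is a flag with g ⊆ f, minlabel(g) = σ, V_f ∈ g, and g ≠ {V_f}, then g ∖ {V_f} is a flag contained in f with minlabel(g ∖ {V_f}) = σ. -/

import Mathlib

open Matrix

variable {n : ℕ} {F : Type} [Field F]

/-- `(r, j)` is a pivot position of `M`: the entry `M r j` is nonzero and all entries of
column `j` strictly below row `r` vanish (i.e. `r` is the largest row index with `M r j ≠ 0`). -/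
def IsPivot (M : Matrix (Fin n) (Fin n) F) (r j : Fin n) : Prop :=
  M r j ≠ 0 ∧ ∀ r' : Fin n, r < r' → M r' j = 0

/-- The span of the first `j` columns of `M` (columns with index `< j` in 0-based indexing). -/
def colSpan (M : Matrix (Fin n) (Fin n) F) (j : ℕ) : Submodule F (Fin n → F) :=
  Submodule.span F ((fun i : Fin n => Mᵀ i) '' {i : Fin n | (i : ℕ) < j})

/-- A flag: a nonempty finite set of proper nonzero subspaces of `F^n` forming a chain. -/
def IsFlag (g : Set (Submodule F (Fin n → F))) : Prop :=
  g.Finite ∧ g.Nonempty ∧ IsChain (· ≤ ·) g ∧ ∀ V ∈ g, V ≠ ⊥ ∧ V ≠ ⊤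

/-- A maximal flag: a flag containing a subspace of every dimension `1,…,n-1`. -/
def IsMaximalFlag (f : Set (Submodule F (Fin n → F))) : Prop :=
  IsFlag f ∧ ∀ j : ℕ, 1 ≤ j → j ≤ n - 1 → ∃ V ∈ f, Module.finrank F V = j

/-- Conditions (i)–(iii) for a matrix representation of a flag `f`:
(i) for every `V ∈ f` the first `dim V` columns of `M` span `V`, and all `n` columns span `F^n`;
(ii) every pivot entry equals `1`;
(iii) entries in the same row as a pivot and strictly to its right vanish. -/
def IsRep (f : Set (Submodule F (Fin n → F))) (M : Matrix (Fin n) (Fin n) F) : Prop :=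
  (∀ V ∈ f, colSpan M (Module.finrank F V) = V) ∧
  colSpan M n = ⊤ ∧
  (∀ r j : Fin n, IsPivot M r j → M r j = 1) ∧
  (∀ r j j' : Fin n, IsPivot M r j → j < j' → M r j' = 0)

/-- Columns `i` and `i'` lie in the same block of the block decomposition induced by the
flag `g` (blocks are the intervals of columns between consecutive dimensions of members of `g`). -/
def SameBlock (g : Set (Submodule F (Fin n → F))) (i i' : Fin n) : Prop :=
  ∀ V ∈ g, ((i : ℕ) < Module.finrank F V ↔ (i' : ℕ) < Module.finrank F V)

/-- The minimal matrix representation of a flag `g`: conditions (i)–(iii) together with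
(iv) within each block, entries in the same row as a pivot of the block and strictly to its left
within the block vanish; (v) within each block, pivot row indices strictly increase. -/
def IsMinRep (g : Set (Submodule F (Fin n → F))) (M : Matrix (Fin n) (Fin n) F) : Prop :=
  IsRep g M ∧
  (∀ r i i' : Fin n, SameBlock g i i' → IsPivot M r i → i' < i → M r i' = 0) ∧
  (∀ r r' i i' : Fin n, SameBlock g i i' → IsPivot M r i → IsPivot M r' i' → i < i' → r < r')

/-- `σ` is the label of the maximal flag `f`: `σ j` is the pivot row of the `j`-th column of
the minimal matrix representation of `f`. -/
def IsLabel (f : Set (Submodule F (Fin n → F))) (σ : Equiv.Perm (Fin n)) : Prop :=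
  ∃ M : Matrix (Fin n) (Fin n) F, IsRep f M ∧ ∀ j : Fin n, IsPivot M (σ j) j

/-- Strict lexicographic order on permutations in one-line notation `(σ 0, …, σ (n-1))`. -/
def LexLt {n : ℕ} (σ τ : Equiv.Perm (Fin n)) : Prop :=
  ∃ j : Fin n, (∀ i : Fin n, i < j → σ i = τ i) ∧ σ j < τ j

/-- `σ` is the lexicographically least label among the labels of maximal flags containing `g`. -/
def IsMinlabel (g : Set (Submodule F (Fin n → F))) (σ : Equiv.Perm (Fin n)) : Prop :=
  (∃ f, IsMaximalFlag f ∧ g ⊆ f ∧ IsLabel f σ) ∧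
  ∀ (f : Set (Submodule F (Fin n → F))) (τ : Equiv.Perm (Fin n)),
    IsMaximalFlag f → g ⊆ f → IsLabel f τ → σ = τ ∨ LexLt σ τ

/-- `t` is a (0-based) ascent of `σ`: `σ t < σ (t+1)`.  (In the 1-based indexing of the paper
this corresponds to the ascent `(σ(t+1), σ(t+2))` at position `t+1`.) -/
def Ascent {n : ℕ} (σ : Equiv.Perm (Fin n)) (t : ℕ) : Prop :=
  ∃ h : t + 1 < n, σ ⟨t, Nat.lt_of_succ_lt h⟩ < σ ⟨t + 1, h⟩

/-- `σ` is the decreasing permutation `σ(j) = n + 1 - j` (in 0-based indexing, `n - 1 - j`). -/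
def IsDecreasing {n : ℕ} (σ : Equiv.Perm (Fin n)) : Prop :=
  ∀ j : Fin n, (σ j : ℕ) = n - 1 - (j : ℕ)

theorem IsPivot.row_unique {M : Matrix (Fin n) (Fin n) F} {r s j : Fin n}
    (hr : IsPivot M r j) (hs : IsPivot M s j) : r = s := by
  rcases lt_trichotomy r s with h | h | h
  · exact absurd (hr.2 s h) hs.1
  · exact h
  · exact absurd (hs.2 r h) hr.1

theorem col_mem_colSpan (M : Matrix (Fin n) (Fin n) F) {d : ℕ} {i : Fin n} (hi : (i : ℕ) < d) :
    Mᵀ i ∈ colSpan M d :=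
  Submodule.subset_span ⟨i, hi, rfl⟩

theorem colSpan_le {M : Matrix (Fin n) (Fin n) F} {d : ℕ} {W : Submodule F (Fin n → F)} :
    colSpan M d ≤ W ↔ ∀ i : Fin n, (i : ℕ) < d → Mᵀ i ∈ W := by
  rw [colSpan, Submodule.span_le]
  exact ⟨fun h i hi => h ⟨i, hi, rfl⟩, by rintro h _ ⟨i, hi, rfl⟩; exact h i hi⟩

theorem colSpan_mono (M : Matrix (Fin n) (Fin n) F) : Monotone (colSpan M) := fun _ _ h =>
  colSpan_le.2 fun _ hi => col_mem_colSpan M (hi.trans_le h)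

theorem exists_coeff_of_mem_colSpan {M : Matrix (Fin n) (Fin n) F} {d : ℕ} {v : Fin n → F}
    (hv : v ∈ colSpan M d) :
    ∃ c : Fin n → F, (∀ i : Fin n, d ≤ i → c i = 0) ∧ ∀ r, v r = ∑ i, M r i * c i := by
  induction hv using Submodule.span_induction with
  | mem v hv =>
    obtain ⟨i, hi, rfl⟩ := hv
    refine ⟨Pi.single i 1, fun k hk => ?_, fun r => ?_⟩
    · rw [Pi.single_eq_of_ne]
      rintro rfl
      exact absurd hi (not_lt.2 hk)
    · simp [Pi.single_apply]
  | zero => exact ⟨0, by simp, by simp⟩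
  | add v w _ _ hv hw =>
    obtain ⟨c, hc, hcv⟩ := hv
    obtain ⟨e, he, hew⟩ := hw
    refine ⟨c + e, fun i hi => by simp [hc i hi, he i hi], fun r => ?_⟩
    simp [hcv, hew, mul_add, Finset.sum_add_distrib]
  | smul a v _ hv =>
    obtain ⟨c, hc, hcv⟩ := hv
    refine ⟨a • c, fun i hi => by simp [hc i hi], fun r => ?_⟩
    simp [hcv, Finset.mul_sum, mul_left_comm]

/-- The position of the last nonzero entry of a vector in the span of the first `d` columns is one
of the first `d` pivot rows. -/
theorem exists_pivot_eq_of_mem_colSpan {M : Matrix (Fin n) (Fin n) F} {σ : Equiv.Perm (Fin n)}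
    (hσ : ∀ j, IsPivot M (σ j) j) {d : ℕ} {v : Fin n → F} (hv : v ∈ colSpan M d) {r : Fin n}
    (hr : v r ≠ 0) (hr' : ∀ s, r < s → v s = 0) : ∃ k : Fin n, (k : ℕ) < d ∧ σ k = r := by
  classical
  obtain ⟨c, hc, hcv⟩ := exists_coeff_of_mem_colSpan hv
  have hne : (Finset.univ.filter fun i => c i ≠ 0).Nonempty := by
    by_contra h
    rw [Finset.not_nonempty_iff_eq_empty, Finset.filter_eq_empty_iff] at h
    exact hr (by rw [hcv]; exact Finset.sum_eq_zero fun i hi => by simp [not_not.1 (h hi)])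
  obtain ⟨k, hk, hmax⟩ := Finset.exists_max_image _ σ hne
  have hk0 : c k ≠ 0 := (Finset.mem_filter.1 hk).2
  have hzero : ∀ s i, σ k ≤ s → σ i ≠ s → M s i * c i = 0 := by
    intro s i hs hi
    by_cases hci : c i = 0
    · simp [hci]
    · have := hmax i (by simp [hci])
      rw [(hσ i).2 s (lt_of_le_of_ne (this.trans hs) hi), zero_mul]
  refine ⟨k, not_le.1 fun h => hk0 (hc k h), ?_⟩
  have hvk : v (σ k) ≠ 0 := by
    rw [hcv, Finset.sum_eq_single k
      (fun i _ hi => hzero _ i le_rfl fun h => hi (σ.injective h)) (by simp)]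
    exact mul_ne_zero (hσ k).1 hk0
  rcases lt_trichotomy (σ k) r with h | h | h
  · refine absurd ?_ hr
    rw [hcv]
    refine Finset.sum_eq_zero fun i _ => ?_
    by_cases hci : c i = 0
    · simp [hci]
    · exact hzero r i h.le ((hmax i (by simp [hci])).trans_lt h).ne
  · exact h
  · exact absurd (hr' _ h) hvk

theorem finrank_colSpan {M : Matrix (Fin n) (Fin n) F} (hM : colSpan M n = ⊤) {d : ℕ}
    (hd : d ≤ n) : Module.finrank F (colSpan M d) = d := by
  have hli : LinearIndependent F Mᵀ := by
    apply linearIndependent_of_top_le_span_of_card_eq_finrank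
    · rw [← hM]
      exact colSpan_le.2 fun i _ => Submodule.subset_span ⟨i, rfl⟩
    · simp
  have hspan : colSpan M d = Submodule.span F (Set.range (Mᵀ ∘ Fin.castLE hd)) := by
    apply le_antisymm
    · exact colSpan_le.2 fun i hi => Submodule.subset_span ⟨⟨i, hi⟩, rfl⟩
    · rw [Submodule.span_le]
      rintro _ ⟨i, rfl⟩
      exact col_mem_colSpan M i.2
  rw [hspan, finrank_span_eq_card (hli.comp _ (Fin.castLE_injective hd)), Fintype.card_fin]

/-- The flag spanned by the initial columns of `M`. -/
def colFlag (M : Matrix (Fin n) (Fin n) F) : Set (Submodule F (Fin n → F)) :=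
  colSpan M '' Set.Icc 1 (n - 1)

theorem isMaximalFlag_colFlag (hn : 2 ≤ n) {M : Matrix (Fin n) (Fin n) F}
    (hM : colSpan M n = ⊤) : IsMaximalFlag (colFlag M) := by
  refine ⟨⟨(Set.finite_Icc _ _).image _, ⟨_, 1, ⟨le_rfl, by omega⟩, rfl⟩, ?_, ?_⟩, ?_⟩
  · rintro _ ⟨i, -, rfl⟩ _ ⟨j, -, rfl⟩ -
    exact (le_total i j).imp (fun h => colSpan_mono M h) (fun h => colSpan_mono M h)
  · rintro _ ⟨i, ⟨hi1, hi2⟩, rfl⟩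
    have hi := finrank_colSpan hM (show i ≤ n by omega)
    constructor <;> intro h <;> rw [h] at hi
    · rw [finrank_bot] at hi; omega
    · rw [finrank_top, Module.finrank_fin_fun] at hi; omega
  · exact fun j h1 h2 => ⟨_, ⟨j, ⟨h1, h2⟩, rfl⟩, finrank_colSpan hM (by omega)⟩

/-- Swap columns `a` and `b` of `M`, then subtract `x` times the new column `a` from column `b`. -/
def swapReduce (M : Matrix (Fin n) (Fin n) F) (a b : Fin n) (x : F) :
    Matrix (Fin n) (Fin n) F :=
  of fun r i => if i = a then M r b else if i = b then M r a - x * M r b else M r i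

theorem swapReduce_left (M : Matrix (Fin n) (Fin n) F) (a b : Fin n) (x : F) (r : Fin n) :
    swapReduce M a b x r a = M r b := by
  simp [swapReduce]

theorem swapReduce_right (M : Matrix (Fin n) (Fin n) F) {a b : Fin n} (hab : a ≠ b) (x : F)
    (r : Fin n) : swapReduce M a b x r b = M r a - x * M r b := by
  simp [swapReduce, hab.symm]

theorem swapReduce_of_ne (M : Matrix (Fin n) (Fin n) F) {a b i : Fin n} (ha : i ≠ a)
    (hb : i ≠ b) (x : F) (r : Fin n) : swapReduce M a b x r i = M r i := by
  simp [swapReduce, ha, hb]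

theorem colSpan_swapReduce (M : Matrix (Fin n) (Fin n) F) {a b : Fin n}
    (hab : (b : ℕ) = a + 1) (x : F) {d : ℕ} (hd : d ≠ b) :
    colSpan (swapReduce M a b x) d = colSpan M d := by
  have hne : a ≠ b := by rintro rfl; omega
  have hcola : (swapReduce M a b x)ᵀ a = Mᵀ b := funext fun r => swapReduce_left M a b x r
  have hcolb : (swapReduce M a b x)ᵀ b = Mᵀ a - x • Mᵀ b :=
    funext fun r => swapReduce_right M hne x r
  have hcol : ∀ i, i ≠ a → i ≠ b → (swapReduce M a b x)ᵀ i = Mᵀ i :=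
    fun i ha hb => funext fun r => swapReduce_of_ne M ha hb x r
  apply le_antisymm <;> refine colSpan_le.2 fun i hi => ?_
  · by_cases ha : i = a
    · subst ha
      rw [hcola]
      exact col_mem_colSpan M (by omega)
    by_cases hb : i = b
    · subst hb
      rw [hcolb]
      exact sub_mem (col_mem_colSpan M (by omega))
        (Submodule.smul_mem _ _ (col_mem_colSpan M hi))
    rw [hcol i ha hb]
    exact col_mem_colSpan M hi
  · by_cases ha : i = a
    · subst ha
      rw [← sub_add_cancel (Mᵀ i) (x • Mᵀ b), ← hcolb, ← hcola]
      exact add_mem (col_mem_colSpan _ (by omega))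
        (Submodule.smul_mem _ _ (col_mem_colSpan _ hi))
    by_cases hb : i = b
    · subst hb
      rw [← hcola]
      exact col_mem_colSpan _ (by omega)
    rw [← hcol i ha hb]
    exact col_mem_colSpan _ hi

/-- If `minlabel g = σ` is the label of a maximal flag through `g`, then every descent of `σ`
occurs at the dimension of a member of `g`. -/
theorem exists_finrank_eq_of_descent {σ : Equiv.Perm (Fin n)}
    {f g : Set (Submodule F (Fin n → F))} (hfσ : IsLabel f σ) (hg : IsFlag g) (hgf : g ⊆ f)
    (hgσ : IsMinlabel g σ) {a b : Fin n} (hab : (b : ℕ) = a + 1) (hlt : σ b < σ a) :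
    ∃ V ∈ g, Module.finrank F V = b := by
  by_contra! hV
  obtain ⟨M, ⟨hspan, htop, hone, hright⟩, hpiv⟩ := hfσ
  have hne : a ≠ b := by rintro rfl; omega
  have hbn := b.2
  set N := swapReduce M a b (M (σ b) a) with hN
  set τ : Equiv.Perm (Fin n) := (Equiv.swap a b).trans σ with hτ
  have hNspan : ∀ d : ℕ, d ≠ b → colSpan N d = colSpan M d :=
    fun d hd => colSpan_swapReduce M hab _ hd
  have hNtop : colSpan N n = ⊤ := by rw [hNspan n (by omega), htop]
  have hNa : ∀ r, N r a = M r b := swapReduce_left M a b _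
  have hNb : ∀ r, N r b = M r a - M (σ b) a * M r b := swapReduce_right M hne _
  have hNi : ∀ r i, i ≠ a → i ≠ b → N r i = M r i :=
    fun r i ha hb => swapReduce_of_ne M ha hb _ r
  have hτa : τ a = σ b := by simp [hτ]
  have hτb : τ b = σ a := by simp [hτ]
  have hτi : ∀ i, i ≠ a → i ≠ b → τ i = σ i := fun i ha hb => by
    simp [hτ, Equiv.swap_apply_of_ne_of_ne ha hb]
  have hMone : ∀ i, M (σ i) i = 1 := fun i => hone _ _ (hpiv i)
  have hMright : ∀ i j, i < j → M (σ i) j = 0 := fun i j h => hright _ _ _ (hpiv i) h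
  have halt : a < b := by rw [Fin.lt_def]; omega
  have hNone : ∀ j, N (τ j) j = 1 := by
    intro j
    by_cases ha : j = a
    · subst ha; rw [hτa, hNa, hMone]
    by_cases hb : j = b
    · subst hb; rw [hτb, hNb, hMone, hMright _ _ halt, mul_zero, sub_zero]
    rw [hτi j ha hb, hNi _ j ha hb, hMone]
  have hNpiv : ∀ j, IsPivot N (τ j) j := by
    intro j
    refine ⟨by rw [hNone]; exact one_ne_zero, fun r hr => ?_⟩
    by_cases ha : j = a
    · subst ha; rw [hτa] at hr; rw [hNa, (hpiv b).2 r hr]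
    by_cases hb : j = b
    · subst hb
      rw [hτb] at hr
      rw [hNb, (hpiv a).2 r hr, (hpiv j).2 r (hlt.trans hr), mul_zero, sub_zero]
    rw [hτi j ha hb] at hr
    rw [hNi _ j ha hb, (hpiv j).2 r hr]
  have hNright : ∀ i j, i < j → N (τ i) j = 0 := by
    intro i j hij
    have hij' : (i : ℕ) < j := hij
    by_cases hia : i = a
    · subst hia
      rw [hτa]
      by_cases hjb : j = b
      · subst hjb; rw [hNb, hMone, mul_one, sub_self]
      rw [hNi _ j hij.ne' hjb, hMright]
      rw [Fin.lt_def]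
      have := Fin.val_ne_of_ne hjb
      omega
    by_cases hib : i = b
    · subst hib
      rw [hτb, hNi _ j (halt.trans hij).ne' hij.ne', hMright _ _ (halt.trans hij)]
    rw [hτi i hia hib]
    by_cases hja : j = a
    · subst hja
      rw [hNa, hMright _ _ (hij.trans halt)]
    by_cases hjb : j = b
    · subst hjb
      have hia' : i < a := by
        rw [Fin.lt_def]
        have := Fin.val_ne_of_ne hia
        omega
      rw [hNb, hMright _ _ hia', hMright _ _ hij, mul_zero, sub_zero]
    rw [hNi _ j hja hjb, hMright _ _ hij]
  have hrep : IsRep (colFlag N) N := by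
    refine ⟨?_, hNtop, fun r j hr => ?_, fun r j j' hr hj => ?_⟩
    · rintro _ ⟨d, ⟨-, hd⟩, rfl⟩
      rw [finrank_colSpan hNtop (by omega)]
    · rw [hr.row_unique (hNpiv j), hNone]
    · rw [hr.row_unique (hNpiv j), hNright _ _ hj]
  have hsub : g ⊆ colFlag N := by
    intro V hVg
    refine ⟨Module.finrank F V, ⟨?_, ?_⟩, ?_⟩
    · exact Submodule.one_le_finrank_iff.2 (hg.2.2.2 V hVg).1
    · have := Submodule.finrank_lt (hg.2.2.2 V hVg).2
      rw [Module.finrank_fin_fun] at this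
      omega
    · rw [hNspan _ (hV V hVg), hspan V (hgf hVg)]
  rcases hgσ.2 _ τ (isMaximalFlag_colFlag (by omega) hNtop) hsub ⟨N, hrep, hNpiv⟩ with h | h
  · rw [← h] at hτa
    exact hne (σ.injective hτa)
  · obtain ⟨j, hj, hjlt⟩ := h
    rcases lt_trichotomy j a with h | h | h
    · rw [hτi j h.ne (h.trans halt).ne] at hjlt
      exact lt_irrefl _ hjlt
    · subst h
      rw [hτa] at hjlt
      exact lt_asymm hlt hjlt
    · have := hj a h
      rw [hτa] at this
      exact hne (σ.injective this)

/-- If `σ j > σ k` with `j < k`, some descent of `σ` lies between `j` and `k`. -/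
theorem exists_descent_between (σ : Equiv.Perm (Fin n)) {j k : Fin n} (hjk : j < k)
    (hlt : σ k < σ j) :
    ∃ a b : Fin n, (b : ℕ) = a + 1 ∧ j ≤ a ∧ b ≤ k ∧ σ b < σ a := by
  by_contra! h
  have hmono : ∀ m : ℕ, (j : ℕ) ≤ m → ∀ hm : m < n, m ≤ k → σ j ≤ σ ⟨m, hm⟩ := by
    intro m hjm
    induction m, hjm using Nat.le_induction with
    | base => exact fun _ _ => le_rfl
    | succ m hjm ih =>
      exact fun hm hmk => (ih (by omega) (by omega)).trans
        (h ⟨m, by omega⟩ ⟨m + 1, hm⟩ rfl hjm hmk)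
  exact absurd (hmono k hjk.le k.2 le_rfl) (not_le.2 hlt)

/-- A label of a maximal flag through `g` all of whose descents occur at dimensions of members of
`g` is the minimal label of `g`. -/
theorem isMinlabel_of_descents {σ : Equiv.Perm (Fin n)} {f g : Set (Submodule F (Fin n → F))}
    (hf : IsMaximalFlag f) (hfσ : IsLabel f σ) (hgf : g ⊆ f)
    (hdesc : ∀ a b : Fin n, (b : ℕ) = a + 1 → σ b < σ a → ∃ V ∈ g, Module.finrank F V = b) :
    IsMinlabel g σ := by
  refine ⟨⟨f, hf, hgf, hfσ⟩, fun f' τ _ hgf' hfτ => ?_⟩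
  obtain ⟨M, hM, hMσ⟩ := hfσ
  obtain ⟨N, hN, hNτ⟩ := hfτ
  refine or_iff_not_imp_left.2 fun hστ => ?_
  have hne : (Finset.univ.filter fun i => σ i ≠ τ i).Nonempty := by
    obtain ⟨i, hi⟩ := not_forall.1 fun h => hστ (Equiv.ext h)
    exact ⟨i, by simp [hi]⟩
  obtain ⟨j, hj, hmin⟩ := Finset.exists_min_image _ id hne
  have hagree : ∀ i, i < j → σ i = τ i := fun i hi => by
    by_contra h
    exact absurd (hmin i (by simp [h])) (not_le.2 hi)
  refine ⟨j, hagree, lt_of_le_of_ne (not_lt.1 fun hlt => ?_) (Finset.mem_filter.1 hj).2⟩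
  obtain ⟨k, hk⟩ := σ.surjective (τ j)
  have hjk : j < k := by
    rcases lt_trichotomy k j with h | h | h
    · rw [hagree k h] at hk
      exact absurd (τ.injective hk) h.ne
    · rw [h] at hk
      exact absurd hk hlt.ne'
    · exact h
  obtain ⟨a, b, hab, hja, hbk, hba⟩ := exists_descent_between σ hjk (hk ▸ hlt)
  obtain ⟨V, hVg, hVb⟩ := hdesc a b hab hba
  have hMV := hM.1 V (hgf hVg)
  have hNV := hN.1 V (hgf' hVg)
  have hjb : (j : ℕ) < Module.finrank F V := by
    rw [Fin.le_def] at hja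
    omega
  have hmem : Nᵀ j ∈ colSpan M (Module.finrank F V) := by
    have := col_mem_colSpan N hjb
    rwa [hNV, ← hMV] at this
  obtain ⟨k', hk', hk'j⟩ := exists_pivot_eq_of_mem_colSpan hMσ hmem (hNτ j).1 (hNτ j).2
  rw [← hk] at hk'j
  rw [σ.injective hk'j] at hk'
  rw [Fin.le_def] at hbk
  omega

/-- with `σ` not the decreasing permutation, `f` a maximal flag with label `σ`,
`t` the smallest ascent of `σ` and `V_f` the subspace of `f` of dimension `t+1`: if `g ⊆ f`
is a flag with `minlabel g = σ`, `V_f ∈ g` and `g ≠ {V_f}`, then `g \ {V_f}` is a flag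
contained in `f` with `minlabel (g \ {V_f}) = σ`. -/
theorem remove_special_vertex_stays_in_X_sigma
    [Fintype F] (hn : 2 ≤ n)
    (σ : Equiv.Perm (Fin n)) (hσ : ¬ IsDecreasing σ)
    (f : Set (Submodule F (Fin n → F))) (hf : IsMaximalFlag f) (hfσ : IsLabel f σ)
    (t : ℕ) (ht : Ascent σ t) (htmin : ∀ t' : ℕ, Ascent σ t' → t ≤ t')
    (Vf : Submodule F (Fin n → F)) (hVf : Vf ∈ f) (hVfdim : Module.finrank F Vf = t + 1)
    (g : Set (Submodule F (Fin n → F))) (hg : IsFlag g) (hgf : g ⊆ f)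
    (hgσ : IsMinlabel g σ) (hVg : Vf ∈ g) (hgne : g ≠ {Vf}) :
    IsFlag (g \ {Vf}) ∧ g \ {Vf} ⊆ f ∧ IsMinlabel (g \ {Vf}) σ := by
  refine ⟨⟨hg.1.subset Set.sdiff_subset, ?_, hg.2.2.1.mono Set.sdiff_subset,
    fun V hV => hg.2.2.2 V hV.1⟩, Set.sdiff_subset.trans hgf,
    isMinlabel_of_descents hf hfσ (Set.sdiff_subset.trans hgf) fun a b hab hlt => ?_⟩
  · rw [Set.sdiff_nonempty]
    exact fun h => hgne (h.antisymm (Set.singleton_subset_iff.2 hVg))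
  · obtain ⟨V, hV, hVb⟩ := exists_finrank_eq_of_descent hfσ hg hgf hgσ hab hlt
    refine ⟨V, ⟨hV, ?_⟩, hVb⟩
    rintro rfl
    obtain ⟨h, hasc⟩ := ht
    have ha : a = ⟨t, Nat.lt_of_succ_lt h⟩ := Fin.ext (by simp only; omega)
    have hb : b = ⟨t + 1, h⟩ := Fin.ext (by simp only; omega)
    rw [ha, hb] at hlt
    exact lt_asymm hasc hlt
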